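/- arXiv:1303.4248 — 3 statements merged into one kernel-verified Lean document; each statement's English description precedes it below -/
import Mathlib

section
/- Let f: T → f(T) be a C³ diffeomorphism of a real interval T, and suppose Sf(x) < −C for all x ∈ T and some constant C > 0. Then for any interval J ⊂ T such that T equals the δ-scaled neighbourhood of J, one has B(f, T, J) > ((1+2δ)/(√(C/2)|T|)) · sinh(√(C/2)|T|/(1+2δ)) ≥ 1 + (1/12) · C|T|²/(1+2δ)². -/
open Set Filter Topology MeasureTheory

noncomputable section

/-- The length of a set of reals (its Lebesgue measure). -/
def slen (S : Set ℝ) : ℝ := (volume S).toReal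

/-- The cross-ratio `D(T,J)` for intervals `T = [t1,t2] ⊇ J = [j1,j2]`. -/
def crossRatio (t1 j1 j2 t2 : ℝ) : ℝ :=
  ((t2 - t1) * (j2 - j1)) / ((j1 - t1) * (t2 - j2))

/-- The cross-ratio distortion `B(f,T,J)` for `T = [t1,t2] ⊇ J = [j1,j2]`. -/
def crDist (f : ℝ → ℝ) (t1 j1 j2 t2 : ℝ) : ℝ :=
  crossRatio (f t1) (f j1) (f j2) (f t2) / crossRatio t1 j1 j2 t2

/-- The Schwarzian derivative of `f`. -/
def schwarzian (f : ℝ → ℝ) (x : ℝ) : ℝ :=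
  iteratedDeriv 3 f x / deriv f x - (3 / 2) * (iteratedDeriv 2 f x / deriv f x) ^ 2

/-- The `l`-scaling `lI` of the interval `I` with endpoints `x ≤ y`
(same centre, half-width multiplied by `l`). -/
def scaledIcc (l x y : ℝ) : Set ℝ :=
  Icc ((x + y) / 2 - l * (y - x) / 2) ((x + y) / 2 + l * (y - x) / 2)

/-- The `l`-scaling of a bounded interval given as a set. -/
def scaledSet (l : ℝ) (S : Set ℝ) : Set ℝ := scaledIcc l (sInf S) (sSup S)

/-- `p` is a periodic point of `g` of (exact) period `n`. -/
def PeriodicPt (g : ℝ → ℝ) (p : ℝ) (n : ℕ) : Prop :=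
  0 < n ∧ g^[n] p = p ∧ ∀ m, 0 < m → m < n → g^[m] p ≠ p

/-- The forward orbit of `p` under `g`. -/
def orbitSet (g : ℝ → ℝ) (p : ℝ) : Set ℝ := Set.range fun k => g^[k] p

/-- The iterates of `x` converge to the set `O`. -/
def ConvergesToOrbit (g : ℝ → ℝ) (x : ℝ) (O : Set ℝ) : Prop :=
  Tendsto (fun k => Metric.infDist (g^[k] x) O) atTop (nhds 0)

/-- The basin of attraction of the set `O`. -/
def Basin (g : ℝ → ℝ) (O : Set ℝ) : Set ℝ := {x | ConvergesToOrbit g x O}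

/-- The immediate basin of attraction of `O` within `N`: the union of the connected
components of the basin which contain points of `O`. -/
def ImmBasinIn (g : ℝ → ℝ) (N : Set ℝ) (O : Set ℝ) : Set ℝ :=
  ⋃ y ∈ O, connectedComponentIn (Basin g O ∩ N) y

/-- `p` is an attracting periodic point of period `n` for the map `g : N → N`. -/
def AttractingIn (g : ℝ → ℝ) (N : Set ℝ) (p : ℝ) (n : ℕ) : Prop :=
  PeriodicPt g p n ∧
    ∃ U : Set ℝ, IsOpen U ∧ p ∈ U ∧ ∀ x ∈ U ∩ N, ConvergesToOrbit g x (orbitSet g p)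

/-- `p` is a neutral periodic point of `g`. -/
def NeutralPeriodicPt (g : ℝ → ℝ) (p : ℝ) (n : ℕ) : Prop :=
  0 < n ∧ g^[n] p = p ∧ |deriv (g^[n]) p| = 1

/-- `g` is `η`-close to `f` in the `C^k` topology on `N`. -/
def CkClose (k : ℕ) (f g : ℝ → ℝ) (N : Set ℝ) (η : ℝ) : Prop :=
  ∀ i ≤ k, ∀ x ∈ N, |iteratedDeriv i g x - iteratedDeriv i f x| ≤ η

/-- `{T k}_{k=0}^m` is a chain for the map `g : N → N`:
each `T k` is a connected component of `g⁻¹(T (k+1))` (within `N`). -/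
def IsChainIn (g : ℝ → ℝ) (N : Set ℝ) (m : ℕ) (T : ℕ → Set ℝ) : Prop :=
  ∀ k < m, (T k).Nonempty ∧ ∀ x ∈ T k, T k = connectedComponentIn (g ⁻¹' T (k + 1) ∩ N) x

/-- `[u,v]` is a periodic interval of period `n` for `g`. -/
def IsPeriodicInterval (g : ℝ → ℝ) (u v : ℝ) (n : ℕ) : Prop :=
  u ≤ v ∧ 0 < n ∧ g^[n] '' Icc u v = Icc u v ∧ InjOn (g^[n]) (Icc u v)

/-- The periodic points of `g` lying in `S`. -/
def periodicPtsIn (g : ℝ → ℝ) (S : Set ℝ) : Set ℝ :=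
  {x ∈ S | ∃ m : ℕ, 0 < m ∧ g^[m] x = x}

/-- A pack of periodic points of `g`: the set of all periodic points in some closed
(possibly degenerate) periodic interval such that no larger periodic interval
contains more periodic points. -/
def IsPack (g : ℝ → ℝ) (P : Set ℝ) : Prop :=
  ∃ u v n, IsPeriodicInterval g u v n ∧ P = periodicPtsIn g (Icc u v) ∧
    ∀ u' v' n', Icc u v ⊆ Icc u' v' → IsPeriodicInterval g u' v' n' →
      periodicPtsIn g (Icc u' v') = P

/-- `f : N → N` has a wandering interval: a nondegenerate interval whose iterates are
pairwise disjoint and which is not contained in the basin of a periodic attractor. -/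
def HasWanderingInterval (f : ℝ → ℝ) (N : Set ℝ) : Prop :=
  ∃ u v : ℝ, u < v ∧ Ioo u v ⊆ N ∧
    (∀ m n : ℕ, m ≠ n → Disjoint (f^[m] '' Ioo u v) (f^[n] '' Ioo u v)) ∧
    ¬ ∃ p ∈ N, ∃ k : ℕ, AttractingIn f N p k ∧
        ∀ x ∈ Ioo u v, ConvergesToOrbit f x (orbitSet f p)

/-- `n` is the orientation preserving period of the periodic point `p`: it is `2m` if
`Dg^m(p) < 0` and `m` if `Dg^m(p) ≥ 0`, where `m` is the period of `p`. -/
def OrientationPreservingPeriod (g : ℝ → ℝ) (p : ℝ) (n : ℕ) : Prop :=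
  ∃ m : ℕ, PeriodicPt g p m ∧
    ((deriv (g^[m]) p < 0 ∧ n = 2 * m) ∨ (0 ≤ deriv (g^[m]) p ∧ n = m))

/-- A function with positive derivative strictly inside an interval increases across it. -/
lemma lt_of_hasDerivAt_pos {g g' : ℝ → ℝ} {a b : ℝ} (hab : a < b)
    (h : ∀ x ∈ Icc a b, HasDerivAt g (g' x) x) (h' : ∀ x ∈ Ioo a b, 0 < g' x) : g a < g b := by
  refine strictMonoOn_of_hasDerivWithinAt_pos (f' := g') (convex_Icc a b)
    (fun x hx => (h x hx).continuousAt.continuousWithinAt) ?_ ?_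
    (left_mem_Icc.2 hab.le) (right_mem_Icc.2 hab.le) hab
  · rw [interior_Icc]
    exact fun x hx => (h x (Ioo_subset_Icc_self hx)).hasDerivWithinAt
  · rwa [interior_Icc]

/-- Sturm comparison with `k⁻¹ sinh (k (x - y))`: a function with the same initial data which
satisfies `G'' > k² G` is larger. -/
lemma sinh_div_lt_of_second_deriv {k y z : ℝ} (hk : 0 < k) (hyz : y < z) {G G' G'' : ℝ → ℝ}
    (h1 : ∀ x ∈ Icc y z, HasDerivAt G (G' x) x) (h2 : ∀ x ∈ Icc y z, HasDerivAt G' (G'' x) x)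
    (h0 : G y = 0) (h0' : G' y = 1) (h : ∀ x ∈ Ioo y z, k ^ 2 * G x < G'' x) :
    Real.sinh (k * (z - y)) / k < G z := by
  have hlin (x : ℝ) : HasDerivAt (fun x => k * (x - y)) k x := by
    simpa using ((hasDerivAt_id x).sub_const y).const_mul k
  have hw : ∀ x ∈ Ioo y z,
      1 < G' x * Real.cosh (k * (x - y)) - k * G x * Real.sinh (k * (x - y)) := by
    intro x hx
    have := lt_of_hasDerivAt_pos
      (g := fun x => G' x * Real.cosh (k * (x - y)) - k * G x * Real.sinh (k * (x - y)))
      (g' := fun x => (G'' x - k ^ 2 * G x) * Real.cosh (k * (x - y)))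
      hx.1 (fun t ht => ?_) (fun t ht => ?_)
    · simpa [h0, h0'] using this
    · have ht' : t ∈ Icc y z := ⟨ht.1, ht.2.trans hx.2.le⟩
      convert! ((h2 t ht').mul (hlin t).cosh).sub (((h1 t ht').const_mul k).mul (hlin t).sinh)
        using 1
      ring
    · exact mul_pos (sub_pos.2 (h t ⟨ht.1, ht.2.trans hx.2⟩)) (Real.cosh_pos _)
  have := lt_of_hasDerivAt_pos
    (g := fun x => (G x - Real.sinh (k * (x - y)) / k) / Real.cosh (k * (x - y)))
    (g' := fun x => (G' x * Real.cosh (k * (x - y)) - k * G x * Real.sinh (k * (x - y)) - 1) /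
      Real.cosh (k * (x - y)) ^ 2)
    hyz (fun t ht => ?_) (fun t ht => ?_)
  · simp only [h0, sub_self, mul_zero, Real.sinh_zero, zero_div] at this
    have := (div_pos_iff_of_pos_right (Real.cosh_pos _)).1 this
    linarith
  · convert! (((h1 t ht).sub ((hlin t).sinh.div_const k))).div (hlin t).cosh
      (Real.cosh_pos _).ne' using 1
    congr 1
    have := Real.cosh_sq (k * (t - y))
    have hk' := hk.ne'
    simp only [Pi.sub_apply]
    field_simp
    linear_combination this
  · exact div_pos (sub_pos.2 (hw t ht)) (pow_pos (Real.cosh_pos _) 2)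

/-- Increasing maps with `Sf < -2k²` expand the infinitesimal cross-ratio at least as much as
`x ↦ tanh (k x)`. -/
lemma deriv_mul_deriv_mul_sinh_sq_lt {k y z : ℝ} (hk : 0 < k) (hyz : y < z)
    {f f1 f2 f3 : ℝ → ℝ} (h1 : ∀ x, HasDerivAt f (f1 x) x) (h2 : ∀ x, HasDerivAt f1 (f2 x) x)
    (h3 : ∀ x, HasDerivAt f2 (f3 x) x) (hpos : ∀ x ∈ Icc y z, 0 < f1 x)
    (hS : ∀ x ∈ Icc y z, f3 x / f1 x - 3 / 2 * (f2 x / f1 x) ^ 2 < -(2 * k ^ 2)) :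
    f1 y * f1 z * Real.sinh (k * (z - y)) ^ 2 < k ^ 2 * (f z - f y) ^ 2 := by
  have hy : y ∈ Icc y z := left_mem_Icc.2 hyz.le
  have hz : z ∈ Icc y z := right_mem_Icc.2 hyz.le
  have hs (x) (hx : x ∈ Icc y z) : 0 < √(f1 x) := Real.sqrt_pos.2 (hpos x hx)
  have hs2 (x) (hx : x ∈ Icc y z) : √(f1 x) ^ 2 = f1 x := Real.sq_sqrt (hpos x hx).le
  have hsd (x) (hx : x ∈ Icc y z) :
      HasDerivAt (fun x => √(f1 x)) (f2 x / (2 * √(f1 x))) x := (h2 x).sqrt (hpos x hx).ne'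
  have key := sinh_div_lt_of_second_deriv hk hyz
    (G := fun x => (√(f1 y))⁻¹ * ((f x - f y) / √(f1 x)))
    (G' := fun x => (√(f1 y))⁻¹ * (√(f1 x) - (f x - f y) * f2 x / (2 * √(f1 x) ^ 3)))
    (G'' := fun x => -((f3 x / f1 x - 3 / 2 * (f2 x / f1 x) ^ 2) / 2) *
      ((√(f1 y))⁻¹ * ((f x - f y) / √(f1 x)))) ?_ ?_ ?_ ?_ ?_
  · have hy0 := hs y hy
    have hz0 := hs z hz
    have hsh : 0 < Real.sinh (k * (z - y)) := Real.sinh_pos_iff.2 (mul_pos hk (sub_pos.2 hyz))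
    rw [← hs2 y hy, ← hs2 z hz, ← mul_pow, ← mul_pow, ← mul_pow]
    refine pow_lt_pow_left₀ ?_ (by positivity) two_ne_zero
    rw [div_lt_iff₀ hk] at key
    calc √(f1 y) * √(f1 z) * Real.sinh (k * (z - y))
        < √(f1 y) * √(f1 z) * ((√(f1 y))⁻¹ * ((f z - f y) / √(f1 z)) * k) := by gcongr
      _ = k * (f z - f y) := by field_simp
  · intro x hx
    have hx0 := (hs x hx).ne'
    convert! (((h1 x).sub_const (f y)).div (hsd x hx) hx0).const_mul (√(f1 y))⁻¹ using 1
    congr 1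
    have := hs2 x hx
    field_simp
    linear_combination (2 * √(f1 x) ^ 2) * this
  · intro x hx
    have hx0 := (hs x hx).ne'
    convert! ((hsd x hx).sub ((((h1 x).sub_const (f y)).mul (h3 x)).div
      (((hsd x hx).pow 3).const_mul 2) (by simpa using hx0))).const_mul (√(f1 y))⁻¹ using 1
    have := hs2 x hx
    rw [← this]
    have hy0 := (hs y hy).ne'
    simp only [Real.sqrt_sq (hs x hx).le, Pi.mul_apply, Pi.pow_apply]
    field_simp
    ring
  · simp
  · have := (hs y hy).ne'
    simp [this]
  · intro x hx
    have hx' := Ioo_subset_Icc_self hx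
    have hfx : f y < f x := lt_of_hasDerivAt_pos hx.1 (fun t _ => h1 t)
      fun t ht => hpos t ⟨ht.1.le, ht.2.le.trans hx'.2⟩
    refine mul_lt_mul_of_pos_right (by linarith [hS x hx']) ?_
    have := hs x hx'
    have := hs y hy
    have := sub_pos.2 hfx
    positivity

/-- Four-point comparison of an increasing map with `Sf < -2k²` against `x ↦ tanh (k x)`. -/
lemma four_point_sinh_lt {k a b c d : ℝ} (hk : 0 < k) (hab : a < b) (hbc : b < c) (hcd : c < d)
    {f f1 f2 f3 : ℝ → ℝ} (h1 : ∀ x, HasDerivAt f (f1 x) x) (h2 : ∀ x, HasDerivAt f1 (f2 x) x)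
    (h3 : ∀ x, HasDerivAt f2 (f3 x) x) (hpos : ∀ x ∈ Icc a d, 0 < f1 x)
    (hS : ∀ x ∈ Icc a d, f3 x / f1 x - 3 / 2 * (f2 x / f1 x) ^ 2 < -(2 * k ^ 2)) :
    (f d - f b) * (f c - f a) * (Real.sinh (k * (d - a)) * Real.sinh (k * (c - b))) <
      (f d - f a) * (f c - f b) * (Real.sinh (k * (d - b)) * Real.sinh (k * (c - a))) := by
  have hmono (x y) (hx : a ≤ x) (hxy : x < y) (hy : y ≤ d) : 0 < f y - f x :=
    sub_pos.2 (lt_of_hasDerivAt_pos hxy (fun t _ => h1 t)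
      fun t ht => hpos t ⟨hx.trans ht.1.le, ht.2.le.trans hy⟩)
  have hsh (x y) (hxy : x < y) : 0 < Real.sinh (k * (y - x)) :=
    Real.sinh_pos_iff.2 (mul_pos hk (sub_pos.2 hxy))
  have hq (y) (hy : y ∈ Icc c d) :
      f1 y / (f y - f b) - k * Real.cosh (k * (y - b)) / Real.sinh (k * (y - b)) <
      f1 y / (f y - f a) - k * Real.cosh (k * (y - a)) / Real.sinh (k * (y - a)) := by
    have := lt_of_hasDerivAt_pos hab
      (g := fun x => k * Real.cosh (k * (y - x)) / Real.sinh (k * (y - x)) - f1 y / (f y - f x))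
      (g' := fun x => k ^ 2 / Real.sinh (k * (y - x)) ^ 2 - f1 x * f1 y / (f y - f x) ^ 2)
      (fun x hx => ?_) (fun x hx => ?_)
    · linarith
    · have hxy : x < y := by linarith [hx.2, hy.1]
      have hlin : HasDerivAt (fun x => k * (y - x)) (-k) x := by
        simpa using ((hasDerivAt_id x).const_sub y).const_mul k
      have hF := (hmono x y hx.1 hxy hy.2).ne'
      have hs := (hsh x y hxy).ne'
      convert! ((hlin.cosh.const_mul k).div hlin.sinh hs).sub
        ((hasDerivAt_const x (f1 y)).div ((h1 x).const_sub (f y)) hF) using 1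
      have := Real.cosh_sq (k * (y - x))
      field_simp
      linear_combination (-(k ^ 2 * (f y - f x) ^ 2)) * this
    · have hxy : x < y := by linarith [hx.2, hy.1]
      have hF := hmono x y hx.1.le hxy hy.2
      have hs := hsh x y hxy
      rw [sub_pos, div_lt_div_iff₀ (by positivity) (by positivity)]
      have hsub : Icc x y ⊆ Icc a d := Icc_subset_Icc hx.1.le hy.2
      exact deriv_mul_deriv_mul_sinh_sq_lt hk hxy h1 h2 h3 (fun t ht => hpos t (hsub ht))
        fun t ht => hS t (hsub ht)
  have hlog (x y) (hx : a ≤ x) (hxy : x < y) (hy : y ≤ d) :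
      HasDerivAt (fun y => Real.log (f y - f x) - Real.log (Real.sinh (k * (y - x))))
        (f1 y / (f y - f x) - k * Real.cosh (k * (y - x)) / Real.sinh (k * (y - x))) y := by
    have hlin : HasDerivAt (fun y => k * (y - x)) k y := by
      simpa using ((hasDerivAt_id y).sub_const x).const_mul k
    convert! (((h1 y).sub_const (f x)).log (hmono x y hx hxy hy).ne').sub
      (hlin.sinh.log (hsh x y hxy).ne') using 2
    rw [mul_comm]
  have hR := lt_of_hasDerivAt_pos hcd
    (fun y hy => (hlog a y le_rfl (by linarith [hy.1]) hy.2).sub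
      (hlog b y hab.le (by linarith [hy.1]) hy.2))
    fun y hy => sub_pos.2 (hq y (Ioo_subset_Icc_self hy))
  simp only [Pi.sub_apply] at hR
  have fda := hmono a d le_rfl (by linarith) le_rfl
  have fdb := hmono b d hab.le (by linarith) le_rfl
  have fca := hmono a c le_rfl (by linarith) hcd.le
  have fcb := hmono b c hab.le hbc hcd.le
  have sda := hsh a d (by linarith)
  have sdb := hsh b d (by linarith)
  have sca := hsh a c (by linarith)
  have scb := hsh b c hbc
  rw [← Real.log_lt_log_iff (by positivity) (by positivity)]
  rw [Real.log_mul (by positivity) (by positivity), Real.log_mul (by positivity) (by positivity),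
    Real.log_mul (by positivity) (by positivity), Real.log_mul (by positivity) (by positivity),
    Real.log_mul (by positivity) (by positivity), Real.log_mul (by positivity) (by positivity)]
  linarith

/-- The Ptolemy identity for `sinh`. -/
lemma sinh_ptolemy (a b c d : ℝ) :
    Real.sinh (d - b) * Real.sinh (c - a) =
      Real.sinh (d - a) * Real.sinh (c - b) + Real.sinh (b - a) * Real.sinh (d - c) := by
  simp only [Real.sinh_sub]
  ring

/-- Cross-ratio comparison of an increasing map with `Sf < -2k²` against `x ↦ tanh (k x)`. -/
lemma sinh_crossRatio_lt {k a b c d : ℝ} (hk : 0 < k) (hab : a < b) (hbc : b < c) (hcd : c < d)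
    {f f1 f2 f3 : ℝ → ℝ} (h1 : ∀ x, HasDerivAt f (f1 x) x) (h2 : ∀ x, HasDerivAt f1 (f2 x) x)
    (h3 : ∀ x, HasDerivAt f2 (f3 x) x) (hpos : ∀ x ∈ Icc a d, 0 < f1 x)
    (hS : ∀ x ∈ Icc a d, f3 x / f1 x - 3 / 2 * (f2 x / f1 x) ^ 2 < -(2 * k ^ 2)) :
    Real.sinh (k * (d - a)) * Real.sinh (k * (c - b)) /
      (Real.sinh (k * (b - a)) * Real.sinh (k * (d - c))) <
      crossRatio (f a) (f b) (f c) (f d) := by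
  have hmono (x y) (hx : a ≤ x) (hxy : x < y) (hy : y ≤ d) : 0 < f y - f x :=
    sub_pos.2 (lt_of_hasDerivAt_pos hxy (fun t _ => h1 t)
      fun t ht => hpos t ⟨hx.trans ht.1.le, ht.2.le.trans hy⟩)
  have hsh (x y) (hxy : x < y) : 0 < Real.sinh (k * (y - x)) :=
    Real.sinh_pos_iff.2 (mul_pos hk (sub_pos.2 hxy))
  have h4 := four_point_sinh_lt hk hab hbc hcd h1 h2 h3 hpos hS
  have hP := sinh_ptolemy (k * a) (k * b) (k * c) (k * d)
  simp only [← mul_sub] at hP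
  have fba := hmono a b le_rfl hab (by linarith)
  have fdc := hmono c d (by linarith) hcd le_rfl
  have sba := hsh a b hab
  have sdc := hsh c d hcd
  rw [crossRatio, div_lt_div_iff₀ (by positivity) (by positivity)]
  rw [hP] at h4
  linarith

lemma sinh_le_mul_cosh {p : ℝ} (hp : 0 ≤ p) : Real.sinh p ≤ p * Real.cosh p := by
  rcases hp.eq_or_lt with rfl | hp
  · simp
  have := lt_of_hasDerivAt_pos hp (g := fun x => x * Real.cosh x - Real.sinh x)
    (g' := fun x => x * Real.sinh x)
    (fun x _ => by
      convert! ((hasDerivAt_id x).mul (Real.hasDerivAt_cosh x)).sub (Real.hasDerivAt_sinh x) using 1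
      simp)
    fun x hx => mul_pos hx.1 (Real.sinh_pos_iff.2 hx.1)
  simp only [zero_mul, Real.sinh_zero, sub_zero] at this
  linarith

lemma add_mul_sinh_sq_le {p s : ℝ} (hp : 0 ≤ p) (hs : 0 ≤ s) :
    (s + 2 * p) * Real.sinh p ^ 2 ≤ p ^ 2 * Real.sinh (s + 2 * p) := by
  have h1 := sinh_le_mul_cosh hp
  have h0 : 0 ≤ Real.sinh p := Real.sinh_nonneg_iff.2 hp
  have hc := Real.one_le_cosh p
  have hss := Real.self_le_sinh_iff.2 hs
  have hcs := Real.one_le_cosh s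
  have hsq : Real.sinh p ^ 2 ≤ p ^ 2 * Real.cosh (2 * p) := by
    rw [Real.cosh_two_mul]
    nlinarith [pow_le_pow_left₀ h0 h1 2, mul_nonneg (sq_nonneg p) (sq_nonneg (Real.sinh p))]
  have h2 : p * Real.sinh p ^ 2 ≤ p ^ 2 * (Real.sinh p * Real.cosh p) := by
    nlinarith [mul_le_mul_of_nonneg_left h1 (mul_nonneg hp h0)]
  have hA : s * Real.sinh p ^ 2 ≤ Real.sinh s * (p ^ 2 * Real.cosh (2 * p)) := by gcongr
  have hB : p ^ 2 * (Real.sinh p * Real.cosh p) ≤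
      Real.cosh s * (p ^ 2 * (Real.sinh p * Real.cosh p)) :=
    le_mul_of_one_le_left (by positivity) hcs
  rw [Real.sinh_add, Real.sinh_two_mul]
  linarith

lemma add_cube_div_six_le_sinh {s : ℝ} (hs : 0 ≤ s) : s + s ^ 3 / 6 ≤ Real.sinh s := by
  have := sum_le_hasSum (Finset.range 2) (fun n _ => by positivity) (Real.hasSum_sinh s)
  norm_num [Finset.sum_range_succ, Nat.factorial] at this
  exact this

lemma crDist_neg (f : ℝ → ℝ) (a b c d : ℝ) : crDist (-f) a b c d = crDist f a b c d := by
  simp only [crDist, crossRatio, Pi.neg_apply]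
  congr 2 <;> ring

lemma schwarzian_neg (f : ℝ → ℝ) (x : ℝ) : schwarzian (-f) x = schwarzian f x := by
  simp [schwarzian, iteratedDeriv_neg, deriv.neg]

/-- The cross-ratio bound for increasing maps, with `J` of length `L` and `T` its `δ`-scaled
neighbourhood. -/
lemma sinh_div_lt_crDist {f : ℝ → ℝ} (hf : ContDiff ℝ 3 f) {k δ L j1 j2 t1 t2 : ℝ} (hk : 0 < k)
    (hδ : 0 < δ) (hL : 0 < L) (hj : j2 - j1 = L) (ht1 : j1 - t1 = δ * L) (ht2 : t2 - j2 = δ * L)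
    (hpos : ∀ x ∈ Icc t1 t2, 0 < deriv f x)
    (hS : ∀ x ∈ Icc t1 t2, schwarzian f x < -(2 * k ^ 2)) :
    Real.sinh (k * L) / (k * L) < crDist f t1 j1 j2 t2 := by
  have hδL : 0 < δ * L := mul_pos hδ hL
  have ht : t2 - t1 = L + 2 * (δ * L) := by linarith
  have hd (n : ℕ) (hn : (n : WithTop ℕ∞) < 3) (x : ℝ) :
      HasDerivAt (iteratedDeriv n f) (iteratedDeriv (n + 1) f x) x := by
    rw [iteratedDeriv_succ]
    exact (hf.differentiable_iteratedDeriv n hn x).hasDerivAt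
  have h0 := hd 0 (by norm_num)
  have h1 := hd 1 (by norm_num)
  have h2 := hd 2 (by norm_num)
  simp only [iteratedDeriv_zero, zero_add, iteratedDeriv_one] at h0 h1
  have hlt := sinh_crossRatio_lt hk (by linarith : t1 < j1) (by linarith : j1 < j2)
    (by linarith : j2 < t2) h0 h1 h2 hpos hS
  have hcr : 0 < crossRatio t1 j1 j2 t2 := by
    rw [crossRatio, hj, ht1, ht2, ht]
    positivity
  rw [crDist, lt_div_iff₀ hcr]
  refine lt_of_le_of_lt ?_ hlt
  rw [crossRatio, hj, ht1, ht2, ht]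
  have hs : 0 < Real.sinh (k * (δ * L)) := Real.sinh_pos_iff.2 (by positivity)
  have hsL : 0 < Real.sinh (k * L) := Real.sinh_pos_iff.2 (by positivity)
  have key := add_mul_sinh_sq_le (p := k * (δ * L)) (s := k * L) (by positivity) (by positivity)
  rw [div_mul_div_comm, div_le_div_iff₀ (by positivity) (by positivity)]
  have := mul_le_mul_of_nonneg_left key (by positivity : 0 ≤ Real.sinh (k * L) * L / k)
  rw [show k * L + 2 * (k * (δ * L)) = k * (L + 2 * (δ * L)) by ring] at this
  convert this using 1 <;> field_simp

/-- If `f : T → f(T)` is a C³ diffeomorphism with `Sf < -C < 0` on `T`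
and `T` is the `δ`-scaled neighbourhood of `J`, then
`B(f,T,J) > ((1+2δ)/(√(C/2)|T|)) sinh(√(C/2)|T|/(1+2δ)) ≥ 1 + C|T|²/(12(1+2δ)²)`. -/
theorem stmt_9 (f : ℝ → ℝ) (hf : ContDiff ℝ 3 f)
    (C δ : ℝ) (hC : 0 < C) (hδ : 0 < δ)
    (j1 j2 t1 t2 : ℝ) (hj : j1 < j2)
    (ht1 : t1 = (j1 + j2) / 2 - (1 + 2 * δ) * (j2 - j1) / 2)
    (ht2 : t2 = (j1 + j2) / 2 + (1 + 2 * δ) * (j2 - j1) / 2)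
    (hdiff : ∀ x ∈ Icc t1 t2, deriv f x ≠ 0)
    (hS : ∀ x ∈ Icc t1 t2, schwarzian f x < -C) :
    crDist f t1 j1 j2 t2 >
      (1 + 2 * δ) / (Real.sqrt (C / 2) * (t2 - t1)) *
        Real.sinh (Real.sqrt (C / 2) * (t2 - t1) / (1 + 2 * δ)) ∧
    (1 + 2 * δ) / (Real.sqrt (C / 2) * (t2 - t1)) *
        Real.sinh (Real.sqrt (C / 2) * (t2 - t1) / (1 + 2 * δ)) ≥
      1 + (1 / 12) * (C * (t2 - t1) ^ 2 / (1 + 2 * δ) ^ 2) := by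
  set L := j2 - j1 with hL
  have hL0 : 0 < L := sub_pos.2 hj
  have hδ' : 0 < 1 + 2 * δ := by linarith
  have hT : t2 - t1 = (1 + 2 * δ) * L := by rw [ht1, ht2]; ring
  set k := Real.sqrt (C / 2) with hk
  have hk0 : 0 < k := Real.sqrt_pos.2 (by linarith)
  have hCk : C = 2 * k ^ 2 := by rw [hk, Real.sq_sqrt (by linarith)]; ring
  have hexpr : (1 + 2 * δ) / (k * (t2 - t1)) * Real.sinh (k * (t2 - t1) / (1 + 2 * δ)) =
      Real.sinh (k * L) / (k * L) := by
    rw [hT, show k * ((1 + 2 * δ) * L) / (1 + 2 * δ) = k * L by field_simp]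
    field_simp
  rw [hexpr]
  constructor
  · rw [hCk] at hS
    have hJ1 : j1 - t1 = δ * L := by rw [ht1, hL]; ring
    have hJ2 : t2 - j2 = δ * L := by rw [ht2, hL]; ring
    have hcont : ContinuousOn (deriv f) (Icc t1 t2) :=
      (hf.continuous_deriv (by norm_num)).continuousOn
    rcases isPreconnected_Icc.mapsTo_Ioi_or_Iio hcont hdiff with h | h
    · exact sinh_div_lt_crDist hf hk0 hδ hL0 hL.symm hJ1 hJ2 h hS
    · rw [← crDist_neg]
      refine sinh_div_lt_crDist hf.neg hk0 hδ hL0 hL.symm hJ1 hJ2 (fun x hx => ?_) fun x hx => ?_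
      · simpa [deriv.neg] using h hx
      · exact (schwarzian_neg f x).trans_lt (hS x hx)
  · have h6 := add_cube_div_six_le_sinh (s := k * L) (by positivity)
    rw [hT, hCk, ge_iff_le, le_div_iff₀ (by positivity)]
    refine le_trans (le_of_eq ?_) h6
    field_simp
    ring
end
end

section
/- There exists a function ρ(ε, d) > 0 such that: if f is a real polynomial of degree at most d, Ĵ ⊂ T̂ are intervals such that T̂ contains an ε-scaled neighbourhood of Ĵ, T is a connected component of f^{-1}(T̂), and J is a connected component of f^{-1}(Ĵ) contained in T, then T contains a ρ(ε, d)-scaled neighbourhood of J. Moreover, for fixed d, ρ(ε, d) → ∞ as ε → ∞. -/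
open Set Filter Topology MeasureTheory

noncomputable section

/-- A real polynomial of degree at most `n` which is bounded by `1` on `[-1, 1]` is bounded by
`cosh (n θ)` for `|x| ≤ cosh θ`. -/
theorem abs_eval_le_cosh_of_forall_abs_le_one {P : Polynomial ℝ} {n : ℕ} (hP : P.natDegree ≤ n)
    (hb : ∀ x ∈ Icc (-1 : ℝ) 1, |P.eval x| ≤ 1) {θ x : ℝ}
    (hx : |x| ≤ Real.cosh θ) : |P.eval x| ≤ Real.cosh (n * θ) := by
  have key : ∀ Q : Polynomial ℝ, Q.natDegree ≤ n → (∀ x ∈ Icc (-1 : ℝ) 1, |Q.eval x| ≤ 1) →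
      ∀ t : ℝ, 1 ≤ t → t ≤ Real.cosh θ → Q.eval t ≤ Real.cosh (n * θ) := by
    intro Q hQ hQb t ht htθ
    have h := Polynomial.Chebyshev.eval_iterate_derivative_le_of_forall_abs_le_one (k := 0) ht
      (Polynomial.natDegree_le_iff_degree_le.mp hQ) hQb
    simp only [Function.iterate_zero, id] at h
    rw [← Real.cosh_arcosh ht, Polynomial.Chebyshev.T_real_cosh] at h
    rw [← Real.cosh_arcosh ht] at htθ ⊢
    refine h.trans ?_
    rw [Real.cosh_le_cosh] at htθ ⊢
    simp only [Int.cast_natCast, abs_mul]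
    gcongr
  have key_abs : ∀ Q : Polynomial ℝ, Q.natDegree ≤ n → (∀ x ∈ Icc (-1 : ℝ) 1, |Q.eval x| ≤ 1) →
      ∀ t : ℝ, 1 ≤ t → t ≤ Real.cosh θ → |Q.eval t| ≤ Real.cosh (n * θ) := by
    intro Q hQ hQb t ht htθ
    refine abs_le'.mpr ⟨key Q hQ hQb t ht htθ, ?_⟩
    have := key (-Q) (by simpa using hQ) (by simpa using hQb) t ht htθ
    simpa using this
  rcases le_or_gt |x| 1 with h1 | h1
  · exact (hb x (abs_le.mp h1)).trans (Real.one_le_cosh _)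
  · rcases abs_cases x with ⟨hxa, -⟩ | ⟨hxa, -⟩
    · exact key_abs P hP hb x (hxa ▸ h1.le) (hxa ▸ hx)
    · have hdeg : (P.comp (-Polynomial.X)).natDegree ≤ n := by
        rw [Polynomial.natDegree_comp]; simpa using hP
      have := key_abs (P.comp (-Polynomial.X)) hdeg
        (fun t ht => by
          simpa using hb (-t) ⟨by linarith [ht.2], by linarith [ht.1]⟩) (-x)
        (hxa ▸ h1.le) (hxa ▸ hx)
      simpa using this

/-- If a polynomial of degree at most `n` maps `[a, b]` into an interval `I`, then it maps the
`cosh θ`-scaling of `[a, b]` into the `cosh (n θ)`-scaling of `I`. -/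
theorem eval_mem_scaledIcc {f : Polynomial ℝ} {n : ℕ} (hf : f.natDegree ≤ n)
    {a b u v : ℝ} (hab : a ≤ b) (huv : u < v) (hmaps : ∀ z ∈ Icc a b, f.eval z ∈ Icc u v)
    {θ z : ℝ} (hz : z ∈ scaledIcc (Real.cosh θ) a b) :
    f.eval z ∈ scaledIcc (Real.cosh (n * θ)) u v := by
  have hr : 0 < (v - u) / 2 := by linarith
  set L : Polynomial ℝ := Polynomial.C ((b - a) / 2) * Polynomial.X + Polynomial.C ((a + b) / 2)
  set P : Polynomial ℝ :=
    Polynomial.C ((v - u) / 2)⁻¹ * (f.comp L - Polynomial.C ((u + v) / 2)) with hPdef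
  have heval : ∀ x, P.eval x
      = (f.eval ((b - a) / 2 * x + (a + b) / 2) - (u + v) / 2) / ((v - u) / 2) := by
    intro x
    simp [hPdef, L, div_eq_inv_mul]
  have hdeg : P.natDegree ≤ n := by
    refine (Polynomial.natDegree_C_mul_le _ _).trans ?_
    refine (Polynomial.natDegree_sub_C).le.trans ?_
    refine Polynomial.natDegree_comp_le.trans ?_
    calc f.natDegree * L.natDegree ≤ n * 1 := by
          gcongr
          exact Polynomial.natDegree_linear_le
      _ = n := mul_one n
  have hb : ∀ x ∈ Icc (-1 : ℝ) 1, |P.eval x| ≤ 1 := by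
    intro x hx
    obtain ⟨h1, h2⟩ := hmaps ((b - a) / 2 * x + (a + b) / 2)
      ⟨by nlinarith [hx.1], by nlinarith [hx.2]⟩
    rw [heval, abs_div, abs_of_pos hr, div_le_one hr, abs_le]
    constructor <;> linarith
  obtain ⟨x, hx, rfl⟩ : ∃ x, |x| ≤ Real.cosh θ ∧ (b - a) / 2 * x + (a + b) / 2 = z := by
    obtain ⟨hz1, hz2⟩ := hz
    rcases hab.eq_or_lt with rfl | hlt
    · exact ⟨0, by simpa using (Real.cosh_pos θ).le, by simp at hz1 hz2; linarith⟩
    · have hh : 0 < (b - a) / 2 := by linarith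
      refine ⟨(z - (a + b) / 2) / ((b - a) / 2), ?_, by field_simp; ring⟩
      rw [abs_div, abs_of_pos hh, div_le_iff₀ hh, abs_le]
      constructor <;> linarith
  have h := abs_eval_le_cosh_of_forall_abs_le_one hdeg hb hx
  rw [heval, abs_div, abs_of_pos hr, div_le_iff₀ hr, abs_le] at h
  constructor <;> linarith [h.1, h.2]

theorem isBounded_eval_preimage_Icc {f : Polynomial ℝ} (hf : 0 < f.degree) (u v : ℝ) :
    Bornology.IsBounded ((fun z => f.eval z) ⁻¹' Icc u v) := by
  have h := f.tendsto_norm_atTop hf (tendsto_norm_cobounded_atTop (E := ℝ))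
  have hev := h.eventually_gt_atTop (max |u| |v|)
  rw [Bornology.isBounded_def]
  filter_upwards [hev] with z hz hmem
  exact hz.not_ge (abs_le_max_abs_abs hmem.1 hmem.2)

theorem IsPreconnected.Icc_csInf_csSup_subset_closure {S : Set ℝ} (hS : IsPreconnected S)
    (hne : S.Nonempty) (hbdd : Bornology.IsBounded S) : Icc (sInf S) (sSup S) ⊆ closure S :=
  hS.closure.ordConnected.out (csInf_mem_closure hne hbdd.bddBelow)
    (csSup_mem_closure hne hbdd.bddAbove)

/-- The amount of space `ρ` for which `T_{d+1} (1 + 2ρ) = 1 + 2ε`, where `T_{d+1}` is the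
Chebyshev polynomial of degree `d + 1`. -/
def pullbackSpace (ε : ℝ) (d : ℕ) : ℝ :=
  if 0 < ε then (Real.cosh (Real.arcosh (1 + 2 * ε) / (d + 1 : ℕ)) - 1) / 2 else 1

theorem one_add_two_mul_pullbackSpace {ε : ℝ} (hε : 0 < ε) (d : ℕ) :
    1 + 2 * pullbackSpace ε d = Real.cosh (Real.arcosh (1 + 2 * ε) / (d + 1 : ℕ)) := by
  rw [pullbackSpace, if_pos hε]
  ring

theorem pullbackSpace_pos {ε : ℝ} (hε : 0 < ε) (d : ℕ) : 0 < pullbackSpace ε d := by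
  have h : 1 < Real.cosh (Real.arcosh (1 + 2 * ε) / (d + 1 : ℕ)) := by
    rw [Real.one_lt_cosh]
    have := Real.arcosh_pos (x := 1 + 2 * ε) (by linarith)
    positivity
  linarith [one_add_two_mul_pullbackSpace hε d]

theorem tendsto_arcosh_atTop : Tendsto Real.arcosh atTop atTop := by
  refine tendsto_atTop_mono' atTop ?_ Real.tendsto_log_atTop
  filter_upwards [eventually_gt_atTop 0] with x hx
  exact Real.log_le_log hx (le_add_of_nonneg_right (Real.sqrt_nonneg _))

theorem tendsto_cosh_atTop : Tendsto Real.cosh atTop atTop := by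
  refine tendsto_atTop_mono (fun x => ?_) (Real.tendsto_exp_atTop.atTop_div_const two_pos)
  rw [Real.cosh_eq]
  linarith [Real.exp_pos (-x)]

theorem tendsto_pullbackSpace_atTop (d : ℕ) :
    Tendsto (fun ε => pullbackSpace ε d) atTop atTop := by
  have hlin : Tendsto (fun ε : ℝ => 1 + 2 * ε) atTop atTop :=
    tendsto_atTop_add_const_left _ _ (tendsto_id.const_mul_atTop two_pos)
  have hcosh := tendsto_cosh_atTop.comp ((tendsto_arcosh_atTop.comp hlin).atTop_div_const
    (Nat.cast_pos.mpr d.succ_pos : (0 : ℝ) < (d + 1 : ℕ)))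
  refine ((tendsto_atTop_add_const_right _ (-1) hcosh).atTop_div_const two_pos).congr' ?_
  filter_upwards [eventually_gt_atTop 0] with ε hε
  simp [pullbackSpace, hε, sub_eq_add_neg]

/-- The scaling of a bounded interval by a factor at least `1` contains it. -/
theorem subset_scaledSet {S : Set ℝ} (hS : Bornology.IsBounded S) {l : ℝ} (hl : 1 ≤ l) :
    S ⊆ scaledSet l S := by
  intro y hy
  have h1 := csInf_le hS.bddBelow hy
  have h2 := le_csSup hS.bddAbove hy
  constructor <;> nlinarith

/-- Polynomial pullback of space: there is a function `ρ(ε,d) > 0` such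
that if `f` is a polynomial of degree at most `d`, `T̂` contains an `ε`-scaled
neighbourhood of `Ĵ`, `T` is a connected component of `f⁻¹(T̂)` and `J ⊆ T` a connected
component of `f⁻¹(Ĵ)`, then `T` contains a `ρ(ε,d)`-scaled neighbourhood of `J`;
moreover `ρ(ε,d) → ∞` as `ε → ∞` for fixed `d`. -/
theorem stmt_13 :
    ∃ ρ : ℝ → ℕ → ℝ, (∀ (ε : ℝ) (d : ℕ), 0 < ε → 0 < ρ ε d) ∧
      (∀ (d : ℕ) (f : Polynomial ℝ), f.natDegree ≤ d →
        ∀ (ε jh1 jh2 th1 th2 : ℝ), 0 < ε → jh1 < jh2 → th1 < th2 →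
          scaledIcc (1 + 2 * ε) jh1 jh2 ⊆ Icc th1 th2 →
          ∀ (T J : Set ℝ) (x y : ℝ),
            x ∈ T → T = connectedComponentIn ((fun z => f.eval z) ⁻¹' Icc th1 th2) x →
            y ∈ J → J = connectedComponentIn ((fun z => f.eval z) ⁻¹' Icc jh1 jh2) y →
            J ⊆ T →
            scaledSet (1 + 2 * ρ ε d) J ⊆ T) ∧
      (∀ d : ℕ, Tendsto (fun e => ρ e d) atTop atTop) := by
  refine ⟨pullbackSpace, fun ε d hε => pullbackSpace_pos hε d, ?_, tendsto_pullbackSpace_atTop⟩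
  intro d f hf ε jh1 jh2 th1 th2 hε hj _ hsub T J x y hx hT hy hJ hJT
  rcases lt_or_ge 0 f.degree with hdeg | hdeg
  · have hJsub : J ⊆ (fun z => f.eval z) ⁻¹' Icc jh1 jh2 :=
      hJ ▸ connectedComponentIn_subset _ _
    have hJconn : IsPreconnected J := hJ ▸ isPreconnected_connectedComponentIn
    have hbdd := (isBounded_eval_preimage_Icc hdeg jh1 jh2).subset hJsub
    have hclosure := closure_minimal hJsub (isClosed_Icc.preimage f.continuous)
    have hmaps := (hJconn.Icc_csInf_csSup_subset_closure ⟨y, hy⟩ hbdd).trans hclosure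
    have hT' : T = connectedComponentIn ((fun z => f.eval z) ⁻¹' Icc th1 th2) y := by
      rw [hT]
      exact connectedComponentIn_eq (hT ▸ hJT hy)
    rw [hT']
    refine IsPreconnected.subset_connectedComponentIn isPreconnected_Icc
      (subset_scaledSet hbdd (by linarith [pullbackSpace_pos hε d]) hy) fun z hz => hsub ?_
    rw [one_add_two_mul_pullbackSpace hε] at hz
    have hmem := eval_mem_scaledIcc (hf.trans d.le_succ)
      (Real.sInf_le_sSup J hbdd.bddBelow hbdd.bddAbove) hj hmaps hz
    rwa [mul_div_cancel₀ _ (by positivity), Real.cosh_arcosh (by linarith)] at hmem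
  · obtain ⟨c, rfl⟩ : ∃ c, f = Polynomial.C c := ⟨_, Polynomial.eq_C_of_degree_le_zero hdeg⟩
    have hc : c ∈ Icc th1 th2 := by
      have := connectedComponentIn_subset _ _ (hT ▸ hx)
      simpa using this
    have hT' : T = univ := by
      rw [hT]
      simp [preimage_const_of_mem hc, connectedComponentIn_univ,
        PreconnectedSpace.connectedComponent_eq_univ]
    simp [hT']
end
end

section
/- There exists a function ρ(ε, d) > 0 such that: if f is a real polynomial of degree at most d and J ⊂ T are intervals on which f is a diffeomorphism, then D(T, J) < ρ(D(f(T), f(J)), d). Moreover, for fixed d, ρ(ε, d) → 0 as ε → 0. -/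
open Set Filter Topology MeasureTheory

noncomputable section

/-- The coefficients of a real polynomial of degree at most `d` which is bounded by `1` on `[0,1]`
are bounded in terms of `d`. -/
lemma exists_coeff_bound (d : ℕ) : ∃ K : ℝ, 0 < K ∧ ∀ p : Polynomial ℝ, p.natDegree ≤ d →
    (∀ x ∈ Icc (0 : ℝ) 1, |p.eval x| ≤ 1) → ∀ k ∈ Finset.range (d + 1), |p.coeff k| ≤ K := by
  set v : ℕ → ℝ := fun i => i / (d + 1) with hv
  set s := Finset.range (d + 1) with hs
  have hd : (0 : ℝ) < d + 1 := by positivity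
  refine ⟨(∑ k ∈ s, ∑ i ∈ s, |(Lagrange.basis s v i).coeff k|) + 1, by positivity, ?_⟩
  intro p hp hb k hk
  have hinj : Set.InjOn v s := by
    intro a _ b _ hab
    simp only [hv] at hab
    rw [div_left_inj' hd.ne'] at hab
    exact_mod_cast hab
  have hdeg : p.degree < s.card := by
    rw [hs, Finset.card_range]
    exact lt_of_le_of_lt (Polynomial.degree_le_of_natDegree_le hp)
      (by exact_mod_cast Nat.lt_succ_self d)
  have hpk : p.coeff k = ∑ i ∈ s, p.eval (v i) * (Lagrange.basis s v i).coeff k := by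
    conv_lhs => rw [Lagrange.eq_interpolate hinj hdeg, Lagrange.interpolate_apply]
    simp
  have h1 : |p.coeff k| ≤ ∑ i ∈ s, |(Lagrange.basis s v i).coeff k| := by
    rw [hpk]
    refine (Finset.abs_sum_le_sum_abs _ _).trans (Finset.sum_le_sum fun i hi => ?_)
    rw [abs_mul]
    refine mul_le_of_le_one_left (abs_nonneg _) (hb _ ⟨by positivity, ?_⟩)
    rw [hv]
    simp only
    rw [div_le_one hd]
    have := Finset.mem_range.1 hi
    exact_mod_cast this.le
  have h2 := Finset.single_le_sum (s := s)
    (f := fun k => ∑ i ∈ s, |(Lagrange.basis s v i).coeff k|) (fun _ _ => by positivity) hk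
  linarith

/-- Bounds at both ends of `[0,1]` for an increasing polynomial diffeomorphism of `[0,1]`. -/
lemma exists_bound_of_strictMonoOn_unit (d : ℕ) : ∃ A : ℝ, 0 < A ∧ ∀ f : Polynomial ℝ,
    f.natDegree ≤ d → f.eval 0 = 0 → f.eval 1 = 1 →
    StrictMonoOn (fun x => f.eval x) (Icc 0 1) → ∀ x ∈ Ioo (0 : ℝ) 1,
      x ^ d ≤ A * f.eval x ∧ 1 - f.eval x ≤ A * (1 - x) := by
  obtain ⟨K, hK, hbound⟩ := exists_coeff_bound d
  refine ⟨(d + 1) * (K * (d + 1)), by positivity, ?_⟩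
  intro f hf h0 h1 hmono x ⟨hx0, hx1⟩
  have hrange : ∀ y ∈ Icc (0 : ℝ) x, ∀ z ∈ Icc (0 : ℝ) 1, y ≤ z →
      0 ≤ f.eval y ∧ f.eval y ≤ f.eval z := by
    intro y hy z hz hyz
    have hy1 : y ∈ Icc (0 : ℝ) 1 := ⟨hy.1, hy.2.trans hx1.le⟩
    refine ⟨?_, hmono.monotoneOn hy1 hz hyz⟩
    have := hmono.monotoneOn (left_mem_Icc.2 zero_le_one) hy1 hy.1
    simpa only [h0] using this
  have hfx : 0 < f.eval x := by
    have := hmono (left_mem_Icc.2 zero_le_one) ⟨hx0.le, hx1.le⟩ hx0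
    simpa only [h0] using this
  constructor
  · set g : Polynomial ℝ := Polynomial.C (f.eval x)⁻¹ * f.comp (Polynomial.C x * Polynomial.X)
      with hg
    have hgeval : ∀ y, g.eval y = (f.eval x)⁻¹ * f.eval (x * y) := by
      intro y; simp [hg]
    have hgdeg : g.natDegree ≤ d := by
      refine (Polynomial.natDegree_C_mul_le _ _).trans (Polynomial.natDegree_comp_le.trans ?_)
      calc f.natDegree * (Polynomial.C x * Polynomial.X).natDegree ≤ f.natDegree * 1 :=
            Nat.mul_le_mul_left _ (Polynomial.natDegree_C_mul_le _ _ |>.trans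
              Polynomial.natDegree_X_le)
        _ ≤ d := by simpa using hf
    have hgb := hbound g hgdeg (by
      intro y hy
      have := hrange (x * y) ⟨mul_nonneg hx0.le hy.1, mul_le_of_le_one_right hx0.le hy.2⟩ x
        ⟨hx0.le, hx1.le⟩ (mul_le_of_le_one_right hx0.le hy.2)
      rw [hgeval, abs_of_nonneg (mul_nonneg (inv_nonneg.2 hfx.le) this.1), inv_mul_le_one₀ hfx]
      exact this.2)
    have hge : g.eval x⁻¹ = (f.eval x)⁻¹ := by
      rw [hgeval, mul_inv_cancel₀ hx0.ne', h1, mul_one]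
    have hsum : g.eval x⁻¹ ≤ (d + 1) * (K * (x⁻¹) ^ d) := by
      rw [Polynomial.eval_eq_sum_range' (Nat.lt_succ_of_le hgdeg)]
      calc _ ≤ ∑ k ∈ Finset.range (d + 1), K * (x⁻¹) ^ d := by
            refine Finset.sum_le_sum fun k hk => ?_
            have hk' : k ≤ d := Nat.lt_succ_iff.1 (Finset.mem_range.1 hk)
            have hx' : 1 ≤ x⁻¹ := (one_le_inv₀ hx0).2 hx1.le
            exact mul_le_mul ((le_abs_self _).trans (hgb k hk))
              (pow_le_pow_right₀ hx' hk') (by positivity) hK.le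
        _ = _ := by simp
    rw [hge, inv_pow] at hsum
    have hxd : 0 < x ^ d := by positivity
    have h2 : x ^ d ≤ (d + 1) * K * f.eval x := by
      have := mul_le_mul_of_nonneg_left hsum (mul_pos hxd hfx).le
      field_simp at this
      linarith
    refine h2.trans (mul_le_mul_of_nonneg_right ?_ hfx.le)
    have : (1 : ℝ) ≤ d + 1 := by linarith [(Nat.cast_nonneg d : (0 : ℝ) ≤ d)]
    nlinarith [mul_pos (by linarith : (0 : ℝ) < d + 1) hK]
  · have hfb := hbound f hf (by
      intro y hy
      have l0 := hmono.monotoneOn (left_mem_Icc.2 zero_le_one) hy hy.1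
      have l1 := hmono.monotoneOn hy (right_mem_Icc.2 zero_le_one) hy.2
      simp only [h0, h1] at l0 l1
      exact abs_le.2 ⟨by linarith, l1⟩)
    suffices f.eval 1 - f.eval x ≤ (d + 1) * (K * (d + 1)) * (1 - x) by rwa [h1] at this
    rw [Polynomial.eval_eq_sum_range' (Nat.lt_succ_of_le hf),
      Polynomial.eval_eq_sum_range' (Nat.lt_succ_of_le hf), ← Finset.sum_sub_distrib]
    calc _ ≤ ∑ k ∈ Finset.range (d + 1), K * (d + 1) * (1 - x) := by
          refine Finset.sum_le_sum fun k hk => ?_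
          have hk' : (k : ℝ) ≤ d + 1 := by exact_mod_cast (Finset.mem_range.1 hk).le
          have hb : 1 - x ^ k ≤ k * (1 - x) := by
            have := one_add_mul_le_pow (a := x - 1) (by linarith) k
            rw [add_sub_cancel] at this
            linarith
          have hb0 : 0 ≤ 1 - x ^ k := sub_nonneg.2 (pow_le_one₀ hx0.le hx1.le)
          calc _ = f.coeff k * (1 - x ^ k) := by rw [one_pow]; ring
            _ ≤ K * (1 - x ^ k) :=
              mul_le_mul_of_nonneg_right ((le_abs_self _).trans (hfb k hk)) hb0
            _ ≤ K * ((d + 1) * (1 - x)) := by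
              refine mul_le_mul_of_nonneg_left (hb.trans ?_) hK.le
              exact mul_le_mul_of_nonneg_right hk' (by linarith)
            _ = _ := by ring
      _ = _ := by simp only [Finset.sum_const, Finset.card_range, nsmul_eq_mul]; push_cast; ring

/-- The control on length ratios by image length ratios with constant `A` for degree `d`. -/
def ratioBound (A : ℝ) (d : ℕ) (e : ℝ) : ℝ := A * (1 + e) * (A * e) ^ (1 / ((d : ℝ) + 1))

lemma ratioBound_nonneg {A : ℝ} (hA : 0 < A) (d : ℕ) {e : ℝ} (he : 0 ≤ e) :
    0 ≤ ratioBound A d e := by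
  unfold ratioBound; positivity

lemma tendsto_ratioBound (A : ℝ) (d : ℕ) : Tendsto (ratioBound A d) (𝓝 0) (𝓝 0) := by
  have hd : (0 : ℝ) < 1 / ((d : ℝ) + 1) := by positivity
  have h : ContinuousAt (ratioBound A d) 0 := by
    unfold ratioBound
    refine ContinuousAt.mul (by fun_prop) (ContinuousAt.rpow_const (by fun_prop) (Or.inr hd.le))
  have h0 : ratioBound A d 0 = 0 := by
    rw [ratioBound, mul_zero, Real.zero_rpow hd.ne', mul_zero]
  simpa only [ContinuousAt, h0] using h

/-- Adjacent intervals on which a polynomial increases: the ratio of lengths is controlled by the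
ratio of the lengths of the images. -/
lemma exists_ratio_bound (d : ℕ) : ∃ A : ℝ, 0 < A ∧ ∀ f : Polynomial ℝ, f.natDegree ≤ d →
    ∀ p m q e : ℝ, p < m → m < q → StrictMonoOn (fun x => f.eval x) (Icc p q) →
      (f.eval m - f.eval p) / (f.eval q - f.eval m) ≤ e →
      (m - p) / (q - m) ≤ ratioBound A d e := by
  obtain ⟨A, hA, hcore⟩ := exists_bound_of_strictMonoOn_unit d
  refine ⟨A, hA, ?_⟩
  intro f hf p m q e hpm hmq hmono he
  have hpq : 0 < q - p := by linarith
  have hm : m ∈ Icc p q := ⟨hpm.le, hmq.le⟩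
  have hp : p ∈ Icc p q := ⟨le_rfl, by linarith⟩
  have hq : q ∈ Icc p q := ⟨by linarith, le_rfl⟩
  have hfpm : f.eval p < f.eval m := hmono hp hm hpm
  have hfmq : f.eval m < f.eval q := hmono hm hq hmq
  have hfpq : 0 < f.eval q - f.eval p := by linarith
  set g : Polynomial ℝ := Polynomial.C (f.eval q - f.eval p)⁻¹ *
    (f.comp (Polynomial.C (q - p) * Polynomial.X + Polynomial.C p) - Polynomial.C (f.eval p))
    with hg
  have hgeval : ∀ t, g.eval t =
      (f.eval q - f.eval p)⁻¹ * (f.eval ((q - p) * t + p) - f.eval p) := by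
    intro t; simp [hg]
  have hgdeg : g.natDegree ≤ d := by
    refine (Polynomial.natDegree_C_mul_le _ _).trans ?_
    rw [Polynomial.natDegree_sub_C]
    refine Polynomial.natDegree_comp_le.trans ?_
    calc _ ≤ f.natDegree * 1 := Nat.mul_le_mul_left _ Polynomial.natDegree_linear_le
      _ ≤ d := by simpa using hf
  have hmem : ∀ t ∈ Icc (0 : ℝ) 1, (q - p) * t + p ∈ Icc p q := by
    intro t ht
    constructor <;> nlinarith [ht.1, ht.2]
  have hgmono : StrictMonoOn (fun t => g.eval t) (Icc 0 1) := by
    intro s hs t ht hst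
    simp only [hgeval]
    have := hmono (hmem s hs) (hmem t ht) (by nlinarith)
    exact mul_lt_mul_of_pos_left (sub_lt_sub_right this _) (inv_pos.2 hfpq)
  set x := (m - p) / (q - p) with hx
  have hx0 : 0 < x := div_pos (by linarith) hpq
  have hx1 : x < 1 := (div_lt_one hpq).2 (by linarith)
  obtain ⟨hB, hC⟩ := hcore g hgdeg (by simp [hgeval])
    (by rw [hgeval, mul_one, sub_add_cancel, inv_mul_cancel₀ hfpq.ne']) hgmono x ⟨hx0, hx1⟩
  have hgx : g.eval x = (f.eval m - f.eval p) / (f.eval q - f.eval p) := by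
    rw [hgeval, hx, mul_div_cancel₀ _ hpq.ne', sub_add_cancel, div_eq_inv_mul]
  set y := g.eval x with hy
  have hy1 : 1 - y = (f.eval q - f.eval m) / (f.eval q - f.eval p) := by
    rw [hgx]; field_simp; ring
  have hy1pos : 0 < 1 - y := by rw [hy1]; exact div_pos (by linarith) hfpq
  have hy0 : 0 < y := by rw [hgx]; exact div_pos (by linarith) hfpq
  have hye : y / (1 - y) ≤ e := by
    rw [hy1, hgx, div_div_div_cancel_right₀ hfpq.ne']
    exact he
  have hyle : y ≤ e := by
    refine le_trans ?_ hye
    rw [le_div_iff₀ hy1pos]; nlinarith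
  have he0 : 0 < e := hy0.trans_le hyle
  have hinv : 1 ≤ (1 + e) * (1 - y) := by
    rw [div_le_iff₀ hy1pos] at hye
    linarith
  have hxroot : x ≤ (A * e) ^ (1 / ((d : ℝ) + 1)) := by
    have h1 : x ^ (d + 1) ≤ A * e :=
      (pow_le_pow_of_le_one hx0.le hx1.le (Nat.le_succ d)).trans
        (hB.trans (mul_le_mul_of_nonneg_left hyle hA.le))
    have h2 := Real.rpow_le_rpow (by positivity) h1
      (by positivity : (0 : ℝ) ≤ 1 / ((d : ℝ) + 1))
    refine le_trans (le_of_eq ?_) h2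
    rw [one_div, ← Nat.cast_succ]
    exact (Real.pow_rpow_inv_natCast hx0.le (Nat.succ_ne_zero d)).symm
  have hratio : (m - p) / (q - m) = x / (1 - x) := by
    have : 1 - x = (q - m) / (q - p) := by rw [hx]; field_simp; ring
    rw [this, hx, div_div_div_cancel_right₀ hpq.ne']
  have hx1' : 0 < 1 - x := by linarith
  rw [hratio, div_le_iff₀ hx1', ratioBound]
  have h3 : 1 ≤ A * (1 + e) * (1 - x) := by
    calc 1 ≤ (1 + e) * (1 - y) := hinv
      _ ≤ (1 + e) * (A * (1 - x)) := mul_le_mul_of_nonneg_left hC (by linarith)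
      _ = _ := by ring
  calc x ≤ 1 * (A * e) ^ (1 / ((d : ℝ) + 1)) := by rwa [one_mul]
    _ ≤ A * (1 + e) * (1 - x) * (A * e) ^ (1 / ((d : ℝ) + 1)) :=
      mul_le_mul_of_nonneg_right h3 (by positivity)
    _ = _ := by ring

lemma crossRatio_eq {t1 j1 j2 t2 : ℝ} (h1 : t1 < j1) (h3 : j2 < t2) :
    crossRatio t1 j1 j2 t2 =
      (1 + (j2 - j1) / (j1 - t1)) * (1 + (j2 - j1) / (t2 - j2)) - 1 := by
  have : j1 - t1 ≠ 0 := (sub_pos.2 h1).ne'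
  have : t2 - j2 ≠ 0 := (sub_pos.2 h3).ne'
  unfold crossRatio
  field_simp
  ring

lemma crossRatio_neg (t1 j1 j2 t2 : ℝ) :
    crossRatio (-t1) (-j1) (-j2) (-t2) = crossRatio t1 j1 j2 t2 := by
  unfold crossRatio
  congr 1 <;> ring

lemma crossRatio_pos {t1 j1 j2 t2 : ℝ} (h1 : t1 < j1) (h2 : j1 < j2) (h3 : j2 < t2) :
    0 < crossRatio t1 j1 j2 t2 := by
  unfold crossRatio
  exact div_pos (mul_pos (by linarith) (by linarith)) (mul_pos (by linarith) (by linarith))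

/-- The cross-ratio bound for increasing polynomials. -/
lemma exists_crossRatio_bound (d : ℕ) : ∃ A : ℝ, 0 < A ∧ ∀ f : Polynomial ℝ, f.natDegree ≤ d →
    ∀ t1 j1 j2 t2 : ℝ, t1 < j1 → j1 < j2 → j2 < t2 →
      StrictMonoOn (fun x => f.eval x) (Icc t1 t2) →
      0 < crossRatio (f.eval t1) (f.eval j1) (f.eval j2) (f.eval t2) ∧
      crossRatio t1 j1 j2 t2 ≤
        (1 + ratioBound A d
          (crossRatio (f.eval t1) (f.eval j1) (f.eval j2) (f.eval t2))) ^ 2 - 1 := by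
  obtain ⟨A, hA, hratio⟩ := exists_ratio_bound d
  refine ⟨A, hA, ?_⟩
  intro f hf t1 j1 j2 t2 h1 h2 h3 hmono
  have k1 : f.eval t1 < f.eval j1 := hmono ⟨le_rfl, by linarith⟩ ⟨h1.le, by linarith⟩ h1
  have k2 : f.eval j1 < f.eval j2 := hmono ⟨h1.le, by linarith⟩ ⟨by linarith, h3.le⟩ h2
  have k3 : f.eval j2 < f.eval t2 := hmono ⟨by linarith, h3.le⟩ ⟨by linarith, le_rfl⟩ h3
  have hpos := crossRatio_pos k1 k2 k3
  refine ⟨hpos, ?_⟩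
  set e := crossRatio (f.eval t1) (f.eval j1) (f.eval j2) (f.eval t2) with he
  have u0 : 0 < (f.eval j2 - f.eval j1) / (f.eval j1 - f.eval t1) :=
    div_pos (by linarith) (by linarith)
  have v0 : 0 < (f.eval j2 - f.eval j1) / (f.eval t2 - f.eval j2) :=
    div_pos (by linarith) (by linarith)
  have he' := crossRatio_eq k1 k3
  rw [← he] at he'
  have hR : (j2 - j1) / (t2 - j2) ≤ ratioBound A d e :=
    hratio f hf j1 j2 t2 e h2 h3 (hmono.mono (Icc_subset_Icc h1.le le_rfl)) (by nlinarith)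
  have hL : (j2 - j1) / (j1 - t1) ≤ ratioBound A d e := by
    have := hratio (-(f.comp (-Polynomial.X)))
      (by
        rw [Polynomial.natDegree_neg]
        refine Polynomial.natDegree_comp_le.trans ?_
        simpa using hf)
      (-j2) (-j1) (-t1) e (by linarith) (by linarith)
      (by
        intro x hx y hy hxy
        have := hmono (a := -y) (b := -x) ⟨by linarith [hy.2], by linarith [hy.1]⟩
          ⟨by linarith [hx.2], by linarith [hx.1]⟩ (by linarith)
        simpa using this)
      (by
        simp only [Polynomial.eval_neg, Polynomial.eval_comp, Polynomial.eval_X, neg_neg]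
        rw [neg_sub_neg, neg_sub_neg]
        nlinarith)
    rwa [neg_sub_neg, neg_sub_neg] at this
  rw [crossRatio_eq h1 h3]
  have a0 : 0 < (j2 - j1) / (j1 - t1) := div_pos (by linarith) (by linarith)
  have b0 : 0 < (j2 - j1) / (t2 - j2) := div_pos (by linarith) (by linarith)
  rw [pow_two]
  refine sub_le_sub_right (mul_le_mul ?_ ?_ ?_ ?_) 1 <;> linarith

/-- A polynomial without critical points on `[a,b]` is strictly monotone there. -/
lemma strictMonoOn_or_strictMonoOn_neg (f : Polynomial ℝ) {a b : ℝ} (hab : a ≤ b)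
    (hf : ∀ x ∈ Icc a b, f.derivative.eval x ≠ 0) :
    StrictMonoOn (fun x => f.eval x) (Icc a b) ∨
      StrictMonoOn (fun x => (-f).eval x) (Icc a b) := by
  have hpos : ∀ g : Polynomial ℝ, (∀ x ∈ Icc a b, 0 < g.derivative.eval x) →
      StrictMonoOn (fun x => g.eval x) (Icc a b) := by
    intro g hg
    refine strictMonoOn_of_deriv_pos (convex_Icc a b) g.continuous.continuousOn fun x hx => ?_
    rw [Polynomial.deriv]
    exact hg x (interior_subset hx)
  have hivt : ∀ x ∈ Icc a b, ∀ y ∈ Icc a b, f.derivative.eval x < 0 →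
      ¬ 0 < f.derivative.eval y := by
    intro x hx y hy hxn hyp
    obtain ⟨z, hz, hz0⟩ := isPreconnected_Icc.intermediate_value hx hy
      f.derivative.continuous.continuousOn ⟨hxn.le, hyp.le⟩
    exact hf z hz hz0
  have ha : a ∈ Icc a b := ⟨le_rfl, hab⟩
  rcases (hf a ha).lt_or_gt with h | h
  · refine Or.inr (hpos _ fun x hx => ?_)
    rw [Polynomial.derivative_neg, Polynomial.eval_neg, neg_pos]
    exact lt_of_le_of_ne (not_lt.1 (hivt a ha x hx h)) (hf x hx)
  · exact Or.inl (hpos _ fun x hx =>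
      lt_of_le_of_ne (not_lt.1 fun hx' => hivt x hx a ha hx' h) (hf x hx).symm)

/-- Polynomial cross-ratio bound: there is a function `ρ(ε,d) > 0` such
that if `f` is a polynomial of degree at most `d` and `J ⊂ T` are intervals on which `f`
is a diffeomorphism, then `D(T,J) < ρ(D(f(T),f(J)), d)`; moreover `ρ(ε,d) → 0` as
`ε → 0` for fixed `d`. -/
theorem stmt_14 :
    ∃ ρ : ℝ → ℕ → ℝ, (∀ (ε : ℝ) (d : ℕ), 0 < ε → 0 < ρ ε d) ∧
      (∀ (d : ℕ) (f : Polynomial ℝ), f.natDegree ≤ d →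
        ∀ t1 j1 j2 t2 : ℝ, t1 < j1 → j1 < j2 → j2 < t2 →
          (∀ x ∈ Icc t1 t2, f.derivative.eval x ≠ 0) →
          crossRatio t1 j1 j2 t2 <
            ρ (crossRatio (f.eval t1) (f.eval j1) (f.eval j2) (f.eval t2)) d) ∧
      (∀ d : ℕ, Tendsto (fun e => ρ e d) (nhdsWithin 0 (Ioi 0)) (nhds 0)) := by
  choose A hA hbound using exists_crossRatio_bound
  refine ⟨fun e d => (1 + ratioBound (A d) d e) ^ 2 - 1 + e, ?_, ?_, ?_⟩
  · intro e d he
    have := ratioBound_nonneg (hA d) d he.le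
    simp only
    nlinarith
  · intro d f hf t1 j1 j2 t2 h1 h2 h3 hder
    have hT : t1 ≤ t2 := by linarith
    rcases strictMonoOn_or_strictMonoOn_neg f hT hder with h | h
    · obtain ⟨hpos, hle⟩ := hbound d f hf t1 j1 j2 t2 h1 h2 h3 h
      exact lt_add_of_le_of_pos hle hpos
    · obtain ⟨hpos, hle⟩ :=
        hbound d (-f) (by rwa [Polynomial.natDegree_neg]) t1 j1 j2 t2 h1 h2 h3 h
      simp only [Polynomial.eval_neg, crossRatio_neg] at hpos hle
      exact lt_add_of_le_of_pos hle hpos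
  · intro d
    have h := ((((tendsto_ratioBound (A d) d).const_add 1).pow 2).sub_const 1).add
      (tendsto_id (α := ℝ) (x := 𝓝 0))
    simp only [add_zero, one_pow, sub_self, id] at h
    exact h.mono_left nhdsWithin_le_nhds
end
end
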